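/- Let D : ℝ → ℝ be infinitely differentiable, c₀ ∈ ℝ, F(x) = ∫_{c₀}^{x} D(s) ds, and let c : ℝ³ × ℝ → ℝ be infinitely differentiable (jointly in (r,t)), satisfy ∂c/∂t(r,t) = Δ(F ∘ c(·,t))(r) everywhere, and suppose there is a fixed compact set K ⊂ ℝ³ such that for all t the support of r ↦ F(c(r,t)) is contained in K. Define φ(r,t) = Δ(F ∘ c(·,t))(r). Then for every (r,t): D(c(r,t)) · φ(r,t) = −(1/(4π)) · ∂/∂t [ ∫_{ℝ³} φ(r',t) / ‖r − r'‖ dr' ]. -/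

import Mathlib

open MeasureTheory Real
open scoped RealInnerProductSpace

noncomputable section

/-- Euclidean space ℝ³. -/
abbrev E3 := EuclideanSpace ℝ (Fin 3)

/-- Laplacian of a scalar field: sum of second partial derivatives. -/
def lap (u : E3 → ℝ) (x : E3) : ℝ :=
  ∑ i : Fin 3,
    fderiv ℝ (fun y => fderiv ℝ u y (EuclideanSpace.single i 1)) x (EuclideanSpace.single i 1)

/-- Divergence of a vector field: sum of partial derivatives of its components. -/
def dvg (v : E3 → E3) (x : E3) : ℝ :=
  ∑ i : Fin 3, fderiv ℝ v x (EuclideanSpace.single i 1) i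

open Filter Topology Set

lemma hasFDerivAt_add_norm_sq_rpow {a : ℝ} (ha : 0 < a) (r y : E3) (p : ℝ) :
    HasFDerivAt (fun y : E3 => (a + ‖y - r‖ ^ 2) ^ p)
      ((p * (a + ‖y - r‖ ^ 2) ^ (p - 1)) • (2 • innerSL ℝ (y - r))) y := by
  have h1 : HasFDerivAt (fun y : E3 => a + ‖y - r‖ ^ 2) (2 • innerSL ℝ (y - r)) y := by
    have := ((hasFDerivAt_id (𝕜 := ℝ) y).sub_const r).norm_sq.const_add a
    simpa using this
  exact h1.rpow_const (Or.inl (by positivity))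

lemma contDiff_add_norm_sq_rpow {a : ℝ} (ha : 0 < a) (r : E3) (p : ℝ) {n : WithTop ℕ∞} :
    ContDiff ℝ n (fun y : E3 => (a + ‖y - r‖ ^ 2) ^ p) := by
  refine ContDiff.rpow_const_of_ne ?_ fun y => by positivity
  exact contDiff_const.add ((contDiff_id.sub contDiff_const).norm_sq ℝ)

lemma lap_add_norm_sq_rpow {a : ℝ} (ha : 0 < a) (r y : E3) :
    lap (fun y : E3 => (a + ‖y - r‖ ^ 2) ^ (-1 / 2 : ℝ)) y
      = -3 * a * (a + ‖y - r‖ ^ 2) ^ (-5 / 2 : ℝ) := by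
  have h1 : ∀ i : Fin 3, (fun y => fderiv ℝ (fun y : E3 => (a + ‖y - r‖ ^ 2) ^ (-1 / 2 : ℝ)) y
      (EuclideanSpace.single i 1)) =
      fun y => -((a + ‖y - r‖ ^ 2) ^ (-3 / 2 : ℝ) * (y i - r i)) := by
    intro i; funext y
    rw [(hasFDerivAt_add_norm_sq_rpow ha r y _).fderiv]
    simp [EuclideanSpace.inner_single_right]
    norm_num
    ring
  have h2 : ∀ i : Fin 3, fderiv ℝ
      (fun y : E3 => -((a + ‖y - r‖ ^ 2) ^ (-3 / 2 : ℝ) * (y i - r i))) y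
      (EuclideanSpace.single i 1) =
      3 * (a + ‖y - r‖ ^ 2) ^ (-5 / 2 : ℝ) * (y i - r i) ^ 2 -
        (a + ‖y - r‖ ^ 2) ^ (-3 / 2 : ℝ) := by
    intro i
    have h3 : HasFDerivAt (fun y : E3 => y i - r i) (EuclideanSpace.proj i : E3 →L[ℝ] ℝ) y :=
      (EuclideanSpace.proj i : E3 →L[ℝ] ℝ).hasFDerivAt.sub_const _
    have h4 : HasFDerivAt (fun y : E3 => -((a + ‖y - r‖ ^ 2) ^ (-3 / 2 : ℝ) * (y i - r i))) _ y :=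
      ((hasFDerivAt_add_norm_sq_rpow ha r y (-3 / 2)).mul h3).neg
    rw [h4.fderiv]
    simp [EuclideanSpace.inner_single_right]
    norm_num
    ring
  have hs : 0 < a + ‖y - r‖ ^ 2 := by positivity
  have h4 : (a + ‖y - r‖ ^ 2) ^ (-3 / 2 : ℝ) =
      (a + ‖y - r‖ ^ 2) * (a + ‖y - r‖ ^ 2) ^ (-5 / 2 : ℝ) := by
    rw [← Real.rpow_one_add' hs.le (by norm_num)]
    norm_num
  simp only [lap, h1, h2, Fin.sum_univ_three]
  rw [h4]
  have h5 : ‖y - r‖ ^ 2 = (y 0 - r 0) ^ 2 + (y 1 - r 1) ^ 2 + (y 2 - r 2) ^ 2 := by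
    simp [EuclideanSpace.real_norm_sq_eq, Fin.sum_univ_three]
  generalize (a + ‖y - r‖ ^ 2) ^ (-5 / 2 : ℝ) = z
  rw [h5]
  ring

lemma integral_mul_fderiv_fderiv {u g : E3 → ℝ} (hu : ContDiff ℝ 2 u) (hs : HasCompactSupport u)
    (hg : ContDiff ℝ 2 g) (v : E3) :
    ∫ y, fderiv ℝ (fun y => fderiv ℝ u y v) y v * g y =
      ∫ y, u y * fderiv ℝ (fun y => fderiv ℝ g y v) y v := by
  have hu' : ContDiff ℝ 1 (fun y => fderiv ℝ u y v) :=
    (hu.fderiv_right (m := 1) (by norm_num)).clm_apply contDiff_const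
  have hg' : ContDiff ℝ 1 (fun y => fderiv ℝ g y v) :=
    (hg.fderiv_right (m := 1) (by norm_num)).clm_apply contDiff_const
  have hu'' : Continuous (fun y => fderiv ℝ (fun y => fderiv ℝ u y v) y v) :=
    (hu'.continuous_fderiv one_ne_zero).clm_apply continuous_const
  have hg'' : Continuous (fun y => fderiv ℝ (fun y => fderiv ℝ g y v) y v) :=
    (hg'.continuous_fderiv one_ne_zero).clm_apply continuous_const
  have hs' : HasCompactSupport (fun y => fderiv ℝ u y v) := hs.fderiv_apply ℝ v
  have hs'' : HasCompactSupport (fun y => fderiv ℝ (fun y => fderiv ℝ u y v) y v) :=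
    hs'.fderiv_apply ℝ v
  have e1 := integral_mul_fderiv_eq_neg_fderiv_mul_of_integrable (μ := volume)
    (f := fun y => fderiv ℝ u y v) (g := g) (v := v)
    ((hu''.mul hg.continuous).integrable_of_hasCompactSupport hs''.mul_right)
    ((hu'.continuous.mul hg'.continuous).integrable_of_hasCompactSupport hs'.mul_right)
    ((hu'.continuous.mul hg.continuous).integrable_of_hasCompactSupport hs'.mul_right)
    (fun x _ => hu'.differentiable one_ne_zero x)
    (fun x _ => hg.differentiable two_ne_zero x)
  have e2 := integral_mul_fderiv_eq_neg_fderiv_mul_of_integrable (μ := volume)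
    (f := u) (g := fun y => fderiv ℝ g y v) (v := v)
    ((hu'.continuous.mul hg'.continuous).integrable_of_hasCompactSupport hs'.mul_right)
    ((hu.continuous.mul hg'').integrable_of_hasCompactSupport hs.mul_right)
    ((hu.continuous.mul hg'.continuous).integrable_of_hasCompactSupport hs.mul_right)
    (fun x _ => hu.differentiable two_ne_zero x)
    (fun x _ => hg'.differentiable one_ne_zero x)
  linarith

lemma continuous_fderiv_fderiv {u : E3 → ℝ} (hu : ContDiff ℝ 2 u) (v : E3) :
    Continuous (fun y => fderiv ℝ (fun y => fderiv ℝ u y v) y v) :=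
  (((hu.fderiv_right (m := 1) (by norm_num)).clm_apply contDiff_const).continuous_fderiv
    one_ne_zero).clm_apply continuous_const

lemma continuous_lap {u : E3 → ℝ} (hu : ContDiff ℝ 2 u) : Continuous (lap u) :=
  continuous_finsetSum _ fun _ _ => continuous_fderiv_fderiv hu _

lemma hasCompactSupport_fderiv_fderiv {u : E3 → ℝ} (hs : HasCompactSupport u) (v : E3) :
    HasCompactSupport (fun y => fderiv ℝ (fun y => fderiv ℝ u y v) y v) :=
  HasCompactSupport.fderiv_apply ℝ (hs.fderiv_apply ℝ v) v

lemma integral_lap_mul {u g : E3 → ℝ} (hu : ContDiff ℝ 2 u) (hs : HasCompactSupport u)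
    (hg : ContDiff ℝ 2 g) : ∫ y, lap u y * g y = ∫ y, u y * lap g y := by
  simp only [lap, Finset.sum_mul, Finset.mul_sum]
  rw [integral_finsetSum, integral_finsetSum]
  · exact Finset.sum_congr rfl fun i _ => integral_mul_fderiv_fderiv hu hs hg _
  · exact fun i _ => (hu.continuous.mul
      (continuous_fderiv_fderiv hg _)).integrable_of_hasCompactSupport hs.mul_right
  · exact fun i _ => ((continuous_fderiv_fderiv hu _).mul
      hg.continuous).integrable_of_hasCompactSupport
        (hasCompactSupport_fderiv_fderiv hs _).mul_right

lemma hasCompactSupport_lap {u : E3 → ℝ} (hs : HasCompactSupport u) :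
    HasCompactSupport (lap u) := by
  have h : lap u = ∑ i : Fin 3, fun y => fderiv ℝ (fun y => fderiv ℝ u y
      (EuclideanSpace.single i 1)) y (EuclideanSpace.single i 1) := by
    funext y; simp [lap]
  rw [h, Fin.sum_univ_three]
  exact ((hasCompactSupport_fderiv_fderiv hs _).add (hasCompactSupport_fderiv_fderiv hs _)).add
    (hasCompactSupport_fderiv_fderiv hs _)

lemma integral_Ioi_sq_mul_one_add_sq_rpow :
    ∫ y in Ioi (0 : ℝ), y ^ 2 * (1 + y ^ 2) ^ (-5 / 2 : ℝ) = 1 / 3 := by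
  have hd : ∀ x ∈ Ici (0 : ℝ), HasDerivAt (fun y : ℝ => y ^ 3 / 3 * (1 + y ^ 2) ^ (-3 / 2 : ℝ))
      (x ^ 2 * (1 + x ^ 2) ^ (-5 / 2 : ℝ)) x := by
    intro x _
    have hs : 0 < 1 + x ^ 2 := by positivity
    have h4 : (1 + x ^ 2) ^ (-3 / 2 : ℝ) = (1 + x ^ 2) * (1 + x ^ 2) ^ (-5 / 2 : ℝ) := by
      rw [← Real.rpow_one_add' hs.le (by norm_num)]
      norm_num
    have h1 : HasDerivAt (fun y : ℝ => 1 + y ^ 2) (2 * x) x := by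
      simpa using (hasDerivAt_pow 2 x).const_add 1
    have h2 := ((hasDerivAt_pow 3 x).div_const 3).mul
      (h1.rpow_const (p := -3 / 2) (Or.inl hs.ne'))
    refine h2.congr_deriv ?_
    rw [h4]
    norm_num
    ring
  have hl : Tendsto (fun y : ℝ => y ^ 3 / 3 * (1 + y ^ 2) ^ (-3 / 2 : ℝ)) atTop (𝓝 (1 / 3)) := by
    have h0 : Tendsto (fun y : ℝ => 1 + y ^ 2) atTop atTop :=
      tendsto_atTop_add_const_left _ _ (tendsto_pow_atTop two_ne_zero)
    have h1 : Tendsto (fun y : ℝ => (1 - (1 + y ^ 2)⁻¹) ^ (3 / 2 : ℝ) / 3) atTop (𝓝 (1 / 3)) := by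
      have := ((h0.inv_tendsto_atTop.const_sub 1).rpow_const (p := 3 / 2)
        (Or.inl (by norm_num))).div_const 3
      simpa using this
    refine h1.congr' ?_
    filter_upwards [eventually_ge_atTop 0] with y hy
    have hs : 0 < 1 + y ^ 2 := by positivity
    have e : 1 - (1 + y ^ 2)⁻¹ = y ^ 2 / (1 + y ^ 2) := by field_simp; ring
    have e3 : (y ^ 2) ^ (3 / 2 : ℝ) = y ^ 3 := by
      rw [← Real.rpow_natCast y 2, ← Real.rpow_mul hy, ← Real.rpow_natCast y 3]
      norm_num
    rw [e, Real.div_rpow (by positivity) hs.le, e3, neg_div, Real.rpow_neg hs.le]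
    ring
  rw [integral_Ioi_of_hasDerivAt_of_nonneg' hd (fun x _ => by positivity) hl]
  simp

lemma integral_one_add_norm_sq_rpow :
    ∫ y : E3, (1 + ‖y‖ ^ 2) ^ (-5 / 2 : ℝ) = 4 * π / 3 := by
  have h := integral_fun_norm_addHaar (volume : Measure E3)
    (fun x : ℝ => (1 + x ^ 2) ^ (-5 / 2 : ℝ))
  rw [h]
  have hb : (volume : Measure E3).real (Metric.ball 0 1) = π * 4 / 3 := by
    rw [Measure.real, EuclideanSpace.volume_ball_fin_three]
    simp [ENNReal.toReal_ofReal, show 0 ≤ π * 4 / 3 by positivity]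
  have hi := integral_Ioi_sq_mul_one_add_sq_rpow
  simp only [finrank_euclideanSpace, Fintype.card_fin, smul_eq_mul, hb]
  norm_num at hi ⊢
  rw [hi]
  ring

lemma tendsto_integral_mul_add_norm_sq_rpow {u : E3 → ℝ} (hu : Continuous u)
    (hs : HasCompactSupport u) (r : E3) :
    Tendsto (fun ε : ℝ => ∫ y, u y * (-3 * ε ^ 2 * (ε ^ 2 + ‖y - r‖ ^ 2) ^ (-5 / 2 : ℝ)))
      (𝓝[>] 0) (𝓝 (-(4 * π) * u r)) := by
  obtain ⟨M, hM⟩ := hu.bounded_above_of_compact_support hs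
  have hlim : Tendsto (fun ε : ℝ => ∫ z : E3, u (r + ε • z) * (-3 * (1 + ‖z‖ ^ 2) ^ (-5 / 2 : ℝ)))
      (𝓝[>] 0) (𝓝 (∫ z : E3, u r * (-3 * (1 + ‖z‖ ^ 2) ^ (-5 / 2 : ℝ)))) := by
    have hint : Integrable (fun z : E3 => (1 + ‖z‖ ^ 2) ^ (-5 / 2 : ℝ)) :=
      integrable_rpow_neg_one_add_norm_sq (by simp; norm_num)
    have hmeas : Continuous (fun z : E3 => (1 + ‖z‖ ^ 2) ^ (-5 / 2 : ℝ)) :=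
      Continuous.rpow_const (by fun_prop) fun z => Or.inl (by positivity)
    refine tendsto_integral_filter_of_dominated_convergence
      (fun z : E3 => M * (3 * (1 + ‖z‖ ^ 2) ^ (-5 / 2 : ℝ))) ?_ ?_ ((hint.const_mul 3).const_mul M) ?_
    · exact Eventually.of_forall fun ε => by
        refine Continuous.aestronglyMeasurable ?_
        fun_prop
    · refine Eventually.of_forall fun ε => Eventually.of_forall fun z => ?_
      have hp : 0 ≤ (1 + ‖z‖ ^ 2) ^ (-5 / 2 : ℝ) := by positivity
      rw [norm_mul, norm_mul, Real.norm_of_nonneg hp]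
      norm_num
      exact mul_le_mul_of_nonneg_right (by simpa using hM _) (by positivity)
    · refine Eventually.of_forall fun z => Tendsto.mul_const _ ?_
      have hc : Continuous fun ε : ℝ => u (r + ε • z) := by fun_prop
      have := (hc.tendsto 0).mono_left (nhdsWithin_le_nhds (s := Ioi 0))
      simpa using this
  rw [integral_const_mul, integral_const_mul, integral_one_add_norm_sq_rpow] at hlim
  rw [show -(4 * π) * u r = u r * (-3 * (4 * π / 3)) by ring]
  refine hlim.congr' ?_
  filter_upwards [self_mem_nhdsWithin] with ε hε
  have hε : 0 < ε := hε
  rw [← integral_add_left_eq_self (fun y : E3 =>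
    u y * (-3 * ε ^ 2 * (ε ^ 2 + ‖y - r‖ ^ 2) ^ (-5 / 2 : ℝ))) r]
  have h := Measure.integral_comp_smul (volume : Measure E3)
    (fun z : E3 => u (r + z) * (-3 * ε ^ 2 * (ε ^ 2 + ‖r + z - r‖ ^ 2) ^ (-5 / 2 : ℝ))) ε
  simp only [finrank_euclideanSpace, Fintype.card_fin, smul_eq_mul] at h
  rw [abs_of_pos (by positivity), eq_inv_mul_iff_mul_eq₀ (by positivity)] at h
  rw [← h, ← integral_const_mul]
  congr 1
  funext z
  have hz : ε ^ 2 + ‖r + ε • z - r‖ ^ 2 = ε ^ 2 * (1 + ‖z‖ ^ 2) := by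
    rw [add_sub_cancel_left, norm_smul, Real.norm_of_nonneg hε.le]
    ring
  have hp : (ε ^ 2) ^ (-5 / 2 : ℝ) = (ε ^ 5)⁻¹ := by
    rw [← Real.rpow_natCast ε 2, ← Real.rpow_mul hε.le, ← Real.rpow_natCast ε 5,
      ← Real.rpow_neg hε.le]
    norm_num
  rw [hz, Real.mul_rpow (by positivity) (by positivity), hp]
  field_simp

lemma integrable_div_norm_sub {f : E3 → ℝ} (hf : Continuous f) (hs : HasCompactSupport f)
    (r : E3) : Integrable (fun y => f y / ‖r - y‖) := by
  obtain ⟨M, hM⟩ := hf.bounded_above_of_compact_support hs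
  obtain ⟨R, -, hsub⟩ := hs.isCompact.isBounded.subset_ball_lt 0 r
  have hker : IntegrableOn (fun z : E3 => ‖z‖⁻¹) (Metric.ball 0 R) := by
    rw [integrableOn_fun_norm_addHaar (volume : Measure E3) (f := fun x => x⁻¹)]
    have hid : IntegrableOn (fun x : ℝ => x) (Ioo 0 R) :=
      (continuous_id.integrableOn_Icc (a := 0) (b := R)).mono_set Ioo_subset_Icc_self
    refine hid.congr_fun (fun x hx => ?_) measurableSet_Ioo
    have : x ≠ 0 := hx.1.ne'
    simp only [finrank_euclideanSpace, Fintype.card_fin, smul_eq_mul]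
    field_simp
  have hball : IntegrableOn (fun z : E3 => f (r - z) / ‖z‖) (Metric.ball 0 R) := by
    refine (hker.const_mul M).mono' ?_ (Eventually.of_forall fun z => ?_)
    · exact (Measurable.div (by fun_prop) measurable_norm).aestronglyMeasurable
    · rw [norm_div, norm_norm, div_eq_mul_inv]
      exact mul_le_mul_of_nonneg_right (hM _) (by positivity)
  have h := (integrableOn_iff_integrable_of_support_subset fun z hz => ?_).1 hball
  · simpa using h.comp_sub_left r
  · have hfz : f (r - z) ≠ 0 := fun h0 => hz (by simp [h0])
    simpa [dist_eq_norm] using hsub (subset_tsupport f hfz)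

lemma integral_lap_div_norm_sub {u : E3 → ℝ} (hu : ContDiff ℝ 2 u) (hs : HasCompactSupport u)
    (r : E3) :
    ∫ y, lap u y / ‖r - y‖ = -(4 * π) * u r := by
  refine tendsto_nhds_unique ?_ (tendsto_integral_mul_add_norm_sq_rpow hu.continuous hs r)
  refine Tendsto.congr' (f₁ := fun ε : ℝ => ∫ y, lap u y * (ε ^ 2 + ‖y - r‖ ^ 2) ^ (-1 / 2 : ℝ))
    ?_ ?_
  · filter_upwards [self_mem_nhdsWithin] with ε hε
    have hε : 0 < ε ^ 2 := pow_pos hε 2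
    rw [integral_lap_mul hu hs (contDiff_add_norm_sq_rpow hε r _)]
    simp only [lap_add_norm_sq_rpow hε]
  have hne : ∀ᵐ y : E3, y ≠ r := by
    simp [ae_iff, measure_singleton]
  have hroot : ∀ y : E3, (‖y - r‖ ^ 2) ^ (-1 / 2 : ℝ) = ‖r - y‖⁻¹ := by
    intro y
    rw [norm_sub_rev, neg_div, Real.rpow_neg (by positivity), ← Real.sqrt_eq_rpow,
      Real.sqrt_sq (norm_nonneg _)]
  refine tendsto_integral_filter_of_dominated_convergence _ ?_ ?_ (integrable_div_norm_sub
    (continuous_lap hu) (hasCompactSupport_lap hs) r).norm ?_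
  · filter_upwards [self_mem_nhdsWithin] with ε hε
    have hε : 0 < ε := hε
    refine ((continuous_lap hu).mul (Continuous.rpow_const (by fun_prop) fun z => Or.inl ?_)).aestronglyMeasurable
    positivity
  · refine Eventually.of_forall fun ε => ?_
    filter_upwards [hne] with y hy
    have : 0 < ‖y - r‖ := norm_pos_iff.2 (sub_ne_zero.2 hy)
    rw [div_eq_mul_inv _ ‖r - y‖, norm_mul, norm_mul, ← hroot]
    refine mul_le_mul_of_nonneg_left ?_ (norm_nonneg _)
    rw [Real.norm_of_nonneg (by positivity), Real.norm_of_nonneg (by positivity)]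
    exact Real.rpow_le_rpow_of_nonpos (by positivity) (by nlinarith) (by norm_num)
  · filter_upwards [hne] with y hy
    have : 0 < ‖y - r‖ := norm_pos_iff.2 (sub_ne_zero.2 hy)
    rw [div_eq_mul_inv _ ‖r - y‖, ← hroot]
    refine Tendsto.const_mul _ ?_
    have hc : ContinuousAt (fun ε : ℝ => (ε ^ 2 + ‖y - r‖ ^ 2) ^ (-1 / 2 : ℝ)) 0 :=
      ContinuousAt.rpow_const (by fun_prop) (Or.inl (by positivity))
    simpa using hc.tendsto.mono_left (nhdsWithin_le_nhds (s := Ioi 0))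

/-- for the auxiliary function φ = Δ(F ∘ c),
D(c)φ = −(1/4π) ∂/∂t ∫ φ(r',t)/‖r−r'‖ dr'. -/
theorem auxiliary_potential_time_derivative (D : ℝ → ℝ) (hD : ContDiff ℝ (⊤ : ℕ∞) D) (c₀ : ℝ)
    (F : ℝ → ℝ) (hF : ∀ x, F x = ∫ s in c₀..x, D s)
    (c : E3 → ℝ → ℝ)
    (hc : ContDiff ℝ (⊤ : ℕ∞) (fun p : E3 × ℝ => c p.1 p.2))
    (hpde : ∀ (r : E3) (t : ℝ), deriv (c r) t = lap (fun r' => F (c r' t)) r)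
    (K : Set E3) (hK : IsCompact K)
    (hsupp : ∀ t, tsupport (fun r => F (c r t)) ⊆ K)
    (φ : E3 → ℝ → ℝ)
    (hφ : ∀ (r : E3) (t : ℝ), φ r t = lap (fun r' => F (c r' t)) r)
    (r : E3) (t : ℝ) :
    D (c r t) * φ r t
      = -(1 / (4 * π)) * deriv (fun s => ∫ r' : E3, φ r' s / ‖r - r'‖) t := by
  have hF' : ∀ x, HasDerivAt F (D x) x := fun x => by
    rw [funext hF]
    exact intervalIntegral.integral_hasDerivAt_right (hD.continuous.intervalIntegrable _ _)
      (hD.continuous.stronglyMeasurableAtFilter _ _) hD.continuous.continuousAt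
  have hFsmooth : ContDiff ℝ 2 F := by
    have hderiv : deriv F = D := funext fun x => (hF' x).deriv
    rw [show (2 : WithTop ℕ∞) = 1 + 1 by norm_num, contDiff_succ_iff_deriv, hderiv]
    exact ⟨fun x => (hF' x).differentiableAt, by simp, hD.of_le (by exact_mod_cast le_top)⟩
  have hc2 : ContDiff ℝ 2 (fun p : E3 × ℝ => c p.1 p.2) :=
    contDiff_infty.1 hc 2
  have hpot : (fun s => ∫ r' : E3, φ r' s / ‖r - r'‖) = fun s => -(4 * π) * F (c r s) := by
    funext s
    have hu : ContDiff ℝ 2 (fun r' => F (c r' s)) :=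
      hFsmooth.comp (hc2.comp (contDiff_id.prodMk contDiff_const))
    have hs : HasCompactSupport (fun r' => F (c r' s)) :=
      hK.of_isClosed_subset (isClosed_tsupport _) (hsupp s)
    simp only [hφ]
    exact integral_lap_div_norm_sub hu hs r
  have hct : HasDerivAt (c r) (φ r t) t := by
    have hcr : ContDiff ℝ 2 (c r) := hc2.comp (contDiff_const.prodMk contDiff_id)
    rw [hφ, ← hpde]
    exact (hcr.differentiable two_ne_zero t).hasDerivAt
  have hd : HasDerivAt (fun s => -(4 * π) * F (c r s)) (-(4 * π) * (D (c r t) * φ r t)) t :=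
    ((hF' (c r t)).comp t hct).const_mul _
  rw [hpot, hd.deriv]
  field_simp

end
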